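/- Let ω₁ and ω₂ be the alternating bilinear forms on ℂ⁵ with ω₁(x,y) = x₁y₃ − x₃y₁ + x₂y₄ − x₄y₂ and ω₂(x,y) = x₁y₄ − x₄y₁ + x₂y₅ − x₅y₂. If V ⊆ ℂ⁵ is a 3-dimensional subspace which is isotropic for both forms (ω₁(u,w) = 0 and ω₂(u,w) = 0 for all u, w ∈ V), then V = span{e₃, e₄, e₅}. That is, a pencil of skew forms of constant rank four admits a unique common isotropic 3-plane, the orthogonal of its pivot. -/

import Mathlib

/-- The alternating form `ω₁ = e₁*∧e₃* + e₂*∧e₄*` on `ℂ⁵` (0-indexed coordinates). -/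
noncomputable def omega1 : (Fin 5 → ℂ) → (Fin 5 → ℂ) → ℂ := fun x y =>
  x 0 * y 2 - x 2 * y 0 + x 1 * y 3 - x 3 * y 1

/-- The alternating form `ω₂ = e₁*∧e₄* + e₂*∧e₅*` on `ℂ⁵` (0-indexed coordinates). -/
noncomputable def omega2 : (Fin 5 → ℂ) → (Fin 5 → ℂ) → ℂ := fun x y =>
  x 0 * y 3 - x 3 * y 0 + x 1 * y 4 - x 4 * y 1

lemma exists_vanishing (V : Submodule ℂ (Fin 5 → ℂ))
    (hdim : Module.finrank ℂ V = 3) (i j : Fin 5) :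
    ∃ k ∈ V, k ≠ 0 ∧ k i = 0 ∧ k j = 0 := by
  let f : V →ₗ[ℂ] (ℂ × ℂ) :=
    ((LinearMap.proj i).prod (LinearMap.proj j)).comp V.subtype
  have hf : LinearMap.ker f ≠ ⊥ := by
    apply LinearMap.ker_ne_bot_of_finrank_lt
    rw [hdim]
    simp
  obtain ⟨k, hk, hne⟩ := (Submodule.ne_bot_iff _).1 hf
  have hk' : (k : Fin 5 → ℂ) i = 0 ∧ (k : Fin 5 → ℂ) j = 0 := by
    simpa [f] using hk
  exact ⟨k, k.2, fun h => hne (Subtype.ext h), hk'.1, hk'.2⟩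

/-- A pencil of skew forms of constant rank four admits a unique common isotropic
3-plane, namely the orthogonal `span {e₃, e₄, e₅}` of its pivot. -/
theorem unique_common_isotropic_three_plane (V : Submodule ℂ (Fin 5 → ℂ))
    (hdim : Module.finrank ℂ V = 3)
    (h1 : ∀ u ∈ V, ∀ w ∈ V, omega1 u w = 0)
    (h2 : ∀ u ∈ V, ∀ w ∈ V, omega2 u w = 0) :
    V = Submodule.span ℂ
      ({Pi.single 2 1, Pi.single 3 1, Pi.single 4 1} : Set (Fin 5 → ℂ)) := by
  simp only [omega1, omega2] at h1 h2
  obtain ⟨k, hkV, hk, hk0, hk1⟩ := exists_vanishing V hdim 0 1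
  have ext0 : ∀ w : Fin 5 → ℂ, w 0 = 0 → w 1 = 0 → w 2 = 0 → w 3 = 0 → w 4 = 0 → w = 0 := by
    intro w a b c d e
    ext i
    fin_cases i <;> assumption
  have key : ∀ u ∈ V, ∀ w ∈ V, u 0 * w 1 = u 1 * w 0 := by
    intro u hu w hw
    by_contra hne
    have a1 := h1 u hu k hkV
    have a2 := h2 u hu k hkV
    have b1 := h1 w hw k hkV
    have b2 := h2 w hw k hkV
    rw [hk0, hk1] at a1 a2 b1 b2
    have hd : u 0 * w 1 - u 1 * w 0 ≠ 0 := sub_ne_zero.2 hne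
    refine hk (ext0 k hk0 hk1 ?_ ?_ ?_) <;> apply (mul_eq_zero.1 _).resolve_left hd
    · linear_combination w 1 * a1 - u 1 * b1
    · linear_combination w 1 * a2 - u 1 * b2
    · linear_combination u 0 * b2 - w 0 * a2
  have hzero : ∀ u ∈ V, u 0 = 0 ∧ u 1 = 0 := by
    intro u hu
    have u0 : u 0 = 0 := by
      by_contra hne
      obtain ⟨w, hw, hwne, w0, w4⟩ := exists_vanishing V hdim 0 4
      have w1 : w 1 = 0 := by
        have := key u hu w hw
        simpa [w0, hne] using this
      have a1 := h1 u hu w hw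
      have a2 := h2 u hu w hw
      have w3 : w 3 = 0 := by simpa [w0, w1, w4, hne] using a2
      have w2 : w 2 = 0 := by simpa [w0, w1, w3, hne] using a1
      exact hwne (ext0 w w0 w1 w2 w3 w4)
    refine ⟨u0, ?_⟩
    by_contra hne
    obtain ⟨w, hw, hwne, w1, w2⟩ := exists_vanishing V hdim 1 2
    have w0 : w 0 = 0 := by
      have := key u hu w hw
      simpa [w1, hne] using this
    have a1 := h1 u hu w hw
    have a2 := h2 u hu w hw
    have w3 : w 3 = 0 := by simpa [w0, w1, w2, hne] using a1
    have w4 : w 4 = 0 := by simpa [w0, w1, w3, hne] using a2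
    exact hwne (ext0 w w0 w1 w2 w3 w4)
  apply Submodule.eq_of_le_of_finrank_le
  · intro u hu
    obtain ⟨u0, u1⟩ := hzero u hu
    rw [Submodule.mem_span_triple]
    refine ⟨u 2, u 3, u 4, ?_⟩
    ext i
    fin_cases i <;> simp [u0, u1]
  · rw [hdim]
    classical
    have := finrank_span_finset_le_card (R := ℂ)
      ({Pi.single 2 1, Pi.single 3 1, Pi.single 4 1} : Finset (Fin 5 → ℂ))
    rw [Set.finrank] at this
    rw [Finset.coe_insert, Finset.coe_insert, Finset.coe_singleton] at this
    exact this.trans Finset.card_le_three
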